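/- Under spectral L_S-smoothness, with β = 0 and in the noiseless case (G_t = ∇f(Y_t), σ = 0), choosing μ = 0 and η = √(2Δ/(L_S T)), Schedule-Free Spectral Descent satisfies for every T ≥ 1: (1/T)·Σ_{t=0}^{T−1} ‖∇f(Y_t)‖_* ≤ √(2 L_S Δ / T). -/

import Mathlib

open Matrix MeasureTheory Finset Filter

noncomputable section

/-- Real `m × n` matrices. -/
abbrev Mat (m n : ℕ) := Matrix (Fin m) (Fin n) ℝ

/-- Frobenius (trace) inner product `⟨A, B⟩_F = tr(Aᵀ B)`. -/
def frobInner {m n : ℕ} (A B : Mat m n) : ℝ := ∑ i, ∑ j, A i j * B i j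

/-- Frobenius norm. -/
def frobNorm {m n : ℕ} (A : Mat m n) : ℝ := Real.sqrt (∑ i, ∑ j, (A i j) ^ 2)

/-- Spectral norm (`ℓ₂ → ℓ₂` operator norm, i.e. largest singular value). -/
def specNorm {m n : ℕ} (A : Mat m n) : ℝ :=
  sSup {c : ℝ | ∃ u : Fin n → ℝ, (∑ j, (u j) ^ 2) ≤ 1 ∧
    c = Real.sqrt (∑ i, (A.mulVec u i) ^ 2)}

/-- Nuclear norm (sum of singular values), via duality with the spectral norm. -/
def nucNorm {m n : ℕ} (A : Mat m n) : ℝ :=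
  sSup {c : ℝ | ∃ Q : Mat m n, specNorm Q ≤ 1 ∧ c = frobInner A Q}

/-- `P` is the polar factor `U Vᵀ` of a compact SVD `M = U Σ Vᵀ`
(`U`, `V` with orthonormal columns, `Σ` positive diagonal). -/
def IsPolarFactor {m n : ℕ} (M P : Mat m n) : Prop :=
  ∃ (k : ℕ) (U : Matrix (Fin m) (Fin k) ℝ) (V : Matrix (Fin n) (Fin k) ℝ)
    (s : Fin k → ℝ),
    Uᵀ * U = 1 ∧ Vᵀ * V = 1 ∧ (∀ i, 0 < s i) ∧
    M = U * Matrix.diagonal s * Vᵀ ∧ P = U * Vᵀ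

/-- `gradf` is the gradient of `f` with respect to the Frobenius inner product:
along every line `s ↦ A + s • H`, `f` has derivative `⟨gradf A, H⟩_F` at `s = 0`. -/
def IsGradient {m n : ℕ} (f : Mat m n → ℝ) (gradf : Mat m n → Mat m n) : Prop :=
  ∀ A H : Mat m n, HasDerivAt (fun s : ℝ => f (A + s • H)) (frobInner (gradf A) H) 0

section Norms

variable {m n : ℕ}

lemma frobInner_sub_left (A B C : Mat m n) :
    frobInner (A - B) C = frobInner A C - frobInner B C := by
  simp [frobInner, sub_mul, Finset.sum_sub_distrib]

lemma frobInner_neg_right (A B : Mat m n) : frobInner A (-B) = -frobInner A B := by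
  simp [frobInner]

lemma sqrt_sum_mulVec_sq_le_frobNorm (A : Mat m n) {u : Fin n → ℝ} (hu : ∑ j, (u j) ^ 2 ≤ 1) :
    Real.sqrt (∑ i, (A.mulVec u i) ^ 2) ≤ frobNorm A := by
  refine Real.sqrt_le_sqrt (Finset.sum_le_sum fun i _ => ?_)
  have hcs : (A.mulVec u i) ^ 2 ≤ (∑ j, (A i j) ^ 2) * ∑ j, (u j) ^ 2 :=
    Finset.sum_mul_sq_le_sq_mul_sq Finset.univ (A i) u
  exact hcs.trans (mul_le_of_le_one_right (Finset.sum_nonneg fun j _ => sq_nonneg _) hu)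

lemma sqrt_sum_mulVec_sq_le_specNorm (A : Mat m n) {u : Fin n → ℝ} (hu : ∑ j, (u j) ^ 2 ≤ 1) :
    Real.sqrt (∑ i, (A.mulVec u i) ^ 2) ≤ specNorm A := by
  refine le_csSup ⟨frobNorm A, ?_⟩ ⟨u, hu, rfl⟩
  rintro c ⟨v, hv, rfl⟩
  exact sqrt_sum_mulVec_sq_le_frobNorm A hv

lemma specNorm_le {A : Mat m n} {c : ℝ} (hc : 0 ≤ c)
    (h : ∀ u : Fin n → ℝ, ∑ i, (A.mulVec u i) ^ 2 ≤ c ^ 2 * ∑ j, (u j) ^ 2) :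
    specNorm A ≤ c := by
  refine Real.sSup_le ?_ hc
  rintro _ ⟨u, hu, rfl⟩
  refine Real.sqrt_le_iff.2 ⟨hc, (h u).trans ?_⟩
  exact mul_le_of_le_one_right (sq_nonneg c) hu

lemma sum_mul_mulVec_le_one {Q : Mat m n} (hQ : specNorm Q ≤ 1) {u : Fin m → ℝ} {v : Fin n → ℝ}
    (hu : ∑ i, (u i) ^ 2 ≤ 1) (hv : ∑ j, (v j) ^ 2 ≤ 1) :
    ∑ i, u i * Q.mulVec v i ≤ 1 := by
  have hQv : ∑ i, (Q.mulVec v i) ^ 2 ≤ 1 :=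
    Real.sqrt_le_one.1 ((sqrt_sum_mulVec_sq_le_specNorm Q hv).trans hQ)
  have hyoung : ∑ i, u i * Q.mulVec v i ≤ ∑ i, ((u i) ^ 2 + (Q.mulVec v i) ^ 2) / 2 :=
    Finset.sum_le_sum fun i _ => by nlinarith [sq_nonneg (u i - Q.mulVec v i)]
  rw [← Finset.sum_div, Finset.sum_add_distrib] at hyoung
  linarith

lemma abs_apply_le_one {Q : Mat m n} (hQ : specNorm Q ≤ 1) (i : Fin m) (j : Fin n) :
    |Q i j| ≤ 1 := by
  have hv : ∑ k, ((Pi.single j 1 : Fin n → ℝ) k) ^ 2 ≤ 1 := by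
    simp [Pi.single_apply]
  have hQv : ∑ k, (Q.mulVec (Pi.single j 1) k) ^ 2 ≤ 1 :=
    Real.sqrt_le_one.1 ((sqrt_sum_mulVec_sq_le_specNorm Q hv).trans hQ)
  rw [← sq_le_one_iff_abs_le_one]
  refine le_trans ?_ hQv
  have := Finset.single_le_sum (f := fun k => (Q.mulVec (Pi.single j 1) k) ^ 2)
    (fun k _ => sq_nonneg _) (Finset.mem_univ i)
  simpa using this

lemma frobInner_le_nucNorm (A : Mat m n) {Q : Mat m n} (hQ : specNorm Q ≤ 1) :
    frobInner A Q ≤ nucNorm A := by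
  refine le_csSup ⟨∑ i, ∑ j, |A i j|, ?_⟩ ⟨Q, hQ, rfl⟩
  rintro _ ⟨R, hR, rfl⟩
  refine Finset.sum_le_sum fun i _ => Finset.sum_le_sum fun j _ => ?_
  calc A i j * R i j ≤ |A i j| * |R i j| := by rw [← abs_mul]; exact le_abs_self _
    _ ≤ |A i j| := mul_le_of_le_one_right (abs_nonneg _) (abs_apply_le_one hR i j)

end Norms

section PolarFactor

variable {m n k : ℕ}

lemma sum_col_sq_of_transpose_mul_self {U : Matrix (Fin m) (Fin k) ℝ} (hU : Uᵀ * U = 1)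
    (a : Fin k) : ∑ i, (U i a) ^ 2 = 1 := by
  have := congrFun (congrFun hU a) a
  simpa [Matrix.mul_apply, sq] using this

lemma sum_sq_mulVec_of_transpose_mul_self {U : Matrix (Fin m) (Fin k) ℝ} (hU : Uᵀ * U = 1)
    (w : Fin k → ℝ) : ∑ i, (U.mulVec w i) ^ 2 = ∑ a, (w a) ^ 2 := by
  have h : (U *ᵥ w) ⬝ᵥ (U *ᵥ w) = w ⬝ᵥ w := by
    rw [Matrix.dotProduct_mulVec, Matrix.vecMul_mulVec, hU, Matrix.vecMul_one]
  simpa [dotProduct, sq] using h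

lemma sum_sq_transpose_mulVec_le {V : Matrix (Fin n) (Fin k) ℝ} (hV : Vᵀ * V = 1)
    (u : Fin n → ℝ) : ∑ a, (Vᵀ.mulVec u a) ^ 2 ≤ ∑ j, (u j) ^ 2 := by
  have hproj := sum_sq_mulVec_of_transpose_mul_self hV (Vᵀ *ᵥ u)
  have hcross : ∑ j, u j * V.mulVec (Vᵀ *ᵥ u) j = ∑ a, (Vᵀ.mulVec u a) ^ 2 := by
    have h : u ⬝ᵥ (V *ᵥ (Vᵀ *ᵥ u)) = (Vᵀ *ᵥ u) ⬝ᵥ (Vᵀ *ᵥ u) := by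
      rw [Matrix.dotProduct_mulVec, Matrix.mulVec_transpose]
    simpa [dotProduct, sq] using h
  have hres : 0 ≤ ∑ j, (u j - V.mulVec (Vᵀ *ᵥ u) j) ^ 2 :=
    Finset.sum_nonneg fun j _ => sq_nonneg _
  have hexpand : ∑ j, (u j - V.mulVec (Vᵀ *ᵥ u) j) ^ 2 =
      ∑ j, (u j) ^ 2 - 2 * ∑ j, u j * V.mulVec (Vᵀ *ᵥ u) j
        + ∑ j, (V.mulVec (Vᵀ *ᵥ u) j) ^ 2 := by
    rw [Finset.mul_sum, ← Finset.sum_sub_distrib, ← Finset.sum_add_distrib]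
    exact Finset.sum_congr rfl fun j _ => by ring
  linarith

lemma frobInner_mul_diagonal_mul_transpose (U : Matrix (Fin m) (Fin k) ℝ)
    (V : Matrix (Fin n) (Fin k) ℝ) (s : Fin k → ℝ) (Q : Mat m n) :
    frobInner (U * Matrix.diagonal s * Vᵀ) Q =
      ∑ a, s a * ∑ i, U i a * Q.mulVec (fun j => V j a) i := by
  simp only [frobInner, Matrix.mul_apply (N := Vᵀ), Matrix.mul_diagonal, Matrix.transpose_apply,
    Matrix.mulVec, dotProduct, Finset.sum_mul, Finset.mul_sum]
  calc _ = ∑ i, ∑ a, ∑ j, U i a * s a * V j a * Q i j :=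
        Finset.sum_congr rfl fun i _ => Finset.sum_comm
    _ = ∑ a, ∑ i, ∑ j, U i a * s a * V j a * Q i j := Finset.sum_comm
    _ = _ := Finset.sum_congr rfl fun a _ => Finset.sum_congr rfl fun i _ =>
        Finset.sum_congr rfl fun j _ => by ring

lemma IsPolarFactor.specNorm_smul_le {M P : Mat m n} (h : IsPolarFactor M P) {c : ℝ}
    (hc : 0 ≤ c) : specNorm (c • P) ≤ c := by
  obtain ⟨k, U, V, s, hU, hV, -, -, rfl⟩ := h
  refine specNorm_le hc fun u => ?_
  simp only [Matrix.smul_mulVec, Pi.smul_apply, smul_eq_mul, mul_pow, ← Finset.mul_sum]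
  refine mul_le_mul_of_nonneg_left ?_ (sq_nonneg c)
  rw [← Matrix.mulVec_mulVec, sum_sq_mulVec_of_transpose_mul_self hU]
  exact sum_sq_transpose_mulVec_le hV u

lemma IsPolarFactor.specNorm_le_one {M P : Mat m n} (h : IsPolarFactor M P) :
    specNorm P ≤ 1 := by
  simpa using h.specNorm_smul_le zero_le_one

lemma IsPolarFactor.nucNorm_le_frobInner {M P : Mat m n} (h : IsPolarFactor M P) :
    nucNorm M ≤ frobInner M P := by
  obtain ⟨k, U, V, s, hU, hV, hs, rfl, rfl⟩ := h
  have hP : frobInner (U * Matrix.diagonal s * Vᵀ) (U * Vᵀ) = ∑ a, s a := by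
    rw [frobInner_mul_diagonal_mul_transpose]
    refine Finset.sum_congr rfl fun a _ => ?_
    have hcol : (U * Vᵀ).mulVec (fun j => V j a) = fun i => U i a := by
      have hmul : U * Vᵀ * V = U := by rw [Matrix.mul_assoc, hV, Matrix.mul_one]
      funext i
      exact congrFun (congrFun hmul i) a
    rw [hcol]
    simp [← sq, sum_col_sq_of_transpose_mul_self hU a]
  rw [hP]
  refine Real.sSup_le ?_ (Finset.sum_nonneg fun a _ => (hs a).le)
  rintro _ ⟨Q, hQ, rfl⟩
  rw [frobInner_mul_diagonal_mul_transpose]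
  refine Finset.sum_le_sum fun a _ => mul_le_of_le_one_right (hs a).le ?_
  exact sum_mul_mulVec_le_one hQ (sum_col_sq_of_transpose_mul_self hU a).le
    (sum_col_sq_of_transpose_mul_self hV a).le

end PolarFactor

section Descent

variable {m n : ℕ} {f : Mat m n → ℝ} {gradf : Mat m n → Mat m n}

lemma IsGradient.hasDerivAt_line (hgrad : IsGradient f gradf) (A H : Mat m n) (x : ℝ) :
    HasDerivAt (fun s : ℝ => f (A + s • H)) (frobInner (gradf (A + x • H)) H) x := by
  have h0 : HasDerivAt (fun s : ℝ => f (A + x • H + s • H))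
      (frobInner (gradf (A + x • H)) H) (x - x) := by
    simpa using hgrad (A + x • H) H
  have h1 := h0.comp_sub_const x x
  refine h1.congr_of_eventuallyEq (Filter.Eventually.of_forall fun s => ?_)
  simp only [add_assoc, ← add_smul, add_sub_cancel]

lemma IsGradient.polar_step_le (hgrad : IsGradient f gradf) {L : ℝ}
    (hsmooth : ∀ A B : Mat m n, nucNorm (gradf A - gradf B) ≤ L * specNorm (A - B)) (hL : 0 ≤ L)
    {Y P : Mat m n} (hP : IsPolarFactor (gradf Y) P) {h : ℝ} (hh : 0 ≤ h) :
    f (Y - h • P) ≤ f Y - h * nucNorm (gradf Y) + L * h ^ 2 / 2 := by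
  set φ : ℝ → ℝ := fun s => f (Y + s • (-P)) + (s * nucNorm (gradf Y) - L * s ^ 2 / 2) with hφ
  have hderiv : ∀ x : ℝ, HasDerivAt φ
      (frobInner (gradf (Y + x • (-P))) (-P) + (nucNorm (gradf Y) - L * x)) x := by
    intro x
    have hlin : HasDerivAt (fun s : ℝ => s * nucNorm (gradf Y)) (nucNorm (gradf Y)) x :=
      hasDerivAt_mul_const _
    have hquad : HasDerivAt (fun s : ℝ => L * s ^ 2 / 2) (L * x) x := by
      refine (((hasDerivAt_pow 2 x).const_mul L).div_const 2).congr_deriv ?_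
      norm_num
      ring
    exact (hgrad.hasDerivAt_line Y (-P) x).add (hlin.sub hquad)
  have hanti : AntitoneOn φ (Set.Ici 0) := by
    refine antitoneOn_of_deriv_nonpos (convex_Ici 0)
      (fun x _ => (hderiv x).continuousAt.continuousWithinAt)
      (fun x _ => (hderiv x).differentiableAt.differentiableWithinAt) fun x hx => ?_
    have hx0 : 0 ≤ x := by
      rw [interior_Ici] at hx
      exact le_of_lt hx
    rw [(hderiv x).deriv, frobInner_neg_right]
    have hdual := frobInner_le_nucNorm (gradf Y - gradf (Y + x • (-P))) hP.specNorm_le_one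
    have hlip := hsmooth Y (Y + x • (-P))
    have hstep : Y - (Y + x • (-P)) = x • P := by simp
    rw [hstep] at hlip
    have hspec := mul_le_mul_of_nonneg_left (hP.specNorm_smul_le hx0) hL
    rw [frobInner_sub_left] at hdual
    linarith [hP.nucNorm_le_frobInner]
  have hle := hanti (Set.self_mem_Ici) (Set.mem_Ici.2 hh) hh
  simp only [hφ, smul_neg, ← sub_eq_add_neg, zero_smul, sub_zero] at hle
  linarith

end Descent

/-- **Noiseless rate for SF Spectral Descent with `β = 0`, `μ = 0`, spectral
smoothness.** With `η = √(2Δ/(L_S T))`, for every `T ≥ 1`: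
`(1/T)·Σ_{t<T} ‖∇f(Y_t)‖_* ≤ √(2 L_S Δ / T)`. -/
theorem sf_spectral_beta0_noiseless_rate {m n : ℕ}
    (f : Mat m n → ℝ) (gradf : Mat m n → Mat m n) (hgrad : IsGradient f gradf)
    (LS : ℝ) (hLS : 0 < LS)
    (hsmooth : ∀ A B : Mat m n, nucNorm (gradf A - gradf B) ≤ LS * specNorm (A - B))
    (fstar : ℝ) (hfstar : ∀ W : Mat m n, fstar ≤ f W)
    (hattain : ∃ W : Mat m n, f W = fstar) :
    ∀ T : ℕ, 1 ≤ T →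
    ∀ Z P : ℕ → Mat m n,
      (∀ t, IsPolarFactor (gradf (Z t)) (P t)) →
      (∀ t, Z (t + 1) = Z t
        - Real.sqrt (2 * (f (Z 0) - fstar) / (LS * T)) • P t) →
      (1 / (T : ℝ)) * ∑ t ∈ Finset.range T, nucNorm (gradf (Z t)) ≤
        Real.sqrt (2 * LS * (f (Z 0) - fstar) / T) := by
  intro T hT Z P hP hZ
  set Δ := f (Z 0) - fstar with hΔ
  set η := Real.sqrt (2 * Δ / (LS * T)) with hη
  have hTpos : (0 : ℝ) < T := by exact_mod_cast hT
  have hΔ0 : 0 ≤ Δ := sub_nonneg.2 (hfstar _)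
  have hη0 : 0 ≤ η := Real.sqrt_nonneg _
  have hηsq : LS * T * η ^ 2 = 2 * Δ := by
    rw [hη, Real.sq_sqrt (by positivity)]
    field_simp
  have hbound : Real.sqrt (2 * LS * Δ / T) = LS * η := by
    have hsq : 2 * LS * Δ / T = (LS * η) ^ 2 := by
      rw [div_eq_iff hTpos.ne']
      linear_combination -LS * hηsq
    rw [hsq, Real.sqrt_sq (by positivity)]
  rw [hbound, one_div, inv_mul_le_iff₀ hTpos]
  rcases hη0.eq_or_lt with hzero | hpos
  · have hfix : ∀ t, Z t = Z 0 := by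
      intro t
      induction t with
      | zero => rfl
      | succ t ih => rw [hZ t, ← hzero, zero_smul, sub_zero, ih]
    have hf0 : f (Z 0) = fstar := by
      rw [← hzero] at hηsq
      linarith
    rw [← hzero, mul_zero, mul_zero]
    refine Finset.sum_nonpos fun t _ => ?_
    rw [hfix t]
    refine le_of_forall_pos_le_add fun ε hε => ?_
    have hh : 0 < ε / LS := by positivity
    have hstep := hgrad.polar_step_le hsmooth hLS.le (hP 0) hh.le
    have hmin := hfstar (Z 0 - (ε / LS) • P 0)
    have hquad : LS * (ε / LS) ^ 2 / 2 = ε / LS * (ε / 2) := by field_simp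
    have : ε / LS * nucNorm (gradf (Z 0)) ≤ ε / LS * (ε / 2) := by linarith
    linarith [le_of_mul_le_mul_left this hh]
  · have hsum : ∀ N : ℕ, η * ∑ t ∈ Finset.range N, nucNorm (gradf (Z t)) ≤
        f (Z 0) - f (Z N) + N * (LS * η ^ 2 / 2) := by
      intro N
      induction N with
      | zero => simp
      | succ N ih =>
        have hstep := hgrad.polar_step_le hsmooth hLS.le (hP N) hη0
        rw [← hZ N] at hstep
        rw [Finset.sum_range_succ, mul_add]
        push_cast
        linarith
    refine le_of_mul_le_mul_left ((hsum T).trans ?_) hpos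
    linarith [hfstar (Z T)]
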